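/- Let X be a bounded Borel subset of ℝ, T : X → X Borel measurable, and μ a T-invariant probability measure absolutely continuous with density h satisfying ∫ |h(s) − h(s − σ)| ds ≤ C' |σ|^β for some C', β > 0 and all σ ∈ ℝ. Suppose (X,T,μ) satisfies the polynomial concentration inequality with moment q ≥ 2. Let ψ : ℝ → ℝ be a bounded, non-negative Lipschitz kernel with bounded support and ∫ ψ(s) ds = 1, and let (α_n) be positive reals. Then there exist constants C_ψ > 0 and D_q > 0 such that for every ε > 0, every n ≥ 1, and every t > C_ψ (α_n^β + 1/(√n α_n²)), the observed density estimator h̃_n(y_0,…,y_{n−1}; s) = (1/(n α_n)) Σ_{j=0}^{n−1} ψ((s − y_j)/α_n) satisfies μ_n ⊗ P^n(∫ |h̃_n(y_0,…,y_{n−1}; s) − h(s)| ds > t + Lip(ψ) ε / α_n²) ≤ D_q ((1 + ε) Lip(ψ) / (t √n α_n²))^q. -/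

import Mathlib

open MeasureTheory Real

noncomputable section

/-- `K` is separately Lipschitz in each of its `n` variables, with
`L j` a Lipschitz constant for the `j`-th variable. -/
def SepLip {n : ℕ} (K : (Fin n → ℝ) → ℝ) (L : Fin n → ℝ) : Prop :=
  ∀ (x : Fin n → ℝ) (j : Fin n) (y : ℝ),
    |K x - K (Function.update x j y)| ≤ L j * dist (x j) y

section helpers

def kde (n : ℕ) (a : ℝ) (ψ : ℝ → ℝ) (y : Fin n → ℝ) (s : ℝ) : ℝ :=
  (1 / ((n : ℝ) * a)) * ∑ j : Fin n, ψ ((s - y j) / a)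

lemma psi_cont {ψ : ℝ → ℝ} {L : ℝ} (hL : 0 ≤ L)
    (hlip : ∀ a b : ℝ, |ψ a - ψ b| ≤ L * |a - b|) : Continuous ψ := by
  have : LipschitzWith ⟨L, hL⟩ ψ := LipschitzWith.of_dist_le_mul (fun a b => by
    rw [Real.dist_eq, Real.dist_eq]; exact hlip a b)
  exact this.continuous

lemma integrable_scaled {ψ : ℝ → ℝ} (hi : Integrable ψ) {a : ℝ} (ha : 0 < a) (y : ℝ) :
    Integrable (fun s => ψ ((s - y) / a)) := by
  exact (hi.comp_div ha.ne').comp_sub_right y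

lemma integral_scaled (ψ : ℝ → ℝ) {a : ℝ} (ha : 0 < a) (y : ℝ) :
    ∫ s, ψ ((s - y) / a) = a * ∫ s, ψ s := by
  rw [integral_sub_right_eq_self (fun s => ψ (s / a)) y, Measure.integral_comp_div]
  simp [abs_of_pos ha]

lemma shift_int {ψ : ℝ → ℝ} {L R a : ℝ} (hL : 0 ≤ L) (hR : 0 < R) (ha : 0 < a)
    (hlip : ∀ a b : ℝ, |ψ a - ψ b| ≤ L * |a - b|)
    (hsupp : ∀ s, R < |s| → ψ s = 0) (y y' : ℝ) :
    ∫ s, |ψ ((s - y) / a) - ψ ((s - y') / a)| ≤ 4 * R * L * |y - y'| := by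
  set c := L * |y - y'| / a with hc
  have hc0 : 0 ≤ c := by positivity
  have hi : ∀ z : ℝ, Integrable ((Set.Icc (z - a * R) (z + a * R)).indicator fun _ => c) := by
    intro z
    rw [integrable_indicator_iff measurableSet_Icc]
    exact integrableOn_const (by simp)
  have hI : ∀ z : ℝ, ∫ s, (Set.Icc (z - a * R) (z + a * R)).indicator (fun _ => c) s
      = 2 * a * R * c := by
    intro z
    rw [integral_indicator measurableSet_Icc, setIntegral_const]
    have : 0 < a * R := by positivity
    simp only [Measure.real, Real.volume_Icc, smul_eq_mul]
    rw [ENNReal.toReal_ofReal (by linarith)]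
    ring
  have hout : ∀ z s : ℝ, s ∉ Set.Icc (z - a * R) (z + a * R) → ψ ((s - z) / a) = 0 := by
    intro z s hs
    apply hsupp
    rw [abs_div, abs_of_pos ha, lt_div_iff₀ ha]
    by_contra hcon
    push Not at hcon
    rw [abs_le] at hcon
    exact hs ⟨by nlinarith, by nlinarith⟩
  calc ∫ s, |ψ ((s - y) / a) - ψ ((s - y') / a)|
      ≤ ∫ s, ((Set.Icc (y - a * R) (y + a * R)).indicator (fun _ => c) s
          + (Set.Icc (y' - a * R) (y' + a * R)).indicator (fun _ => c) s) := by
        apply integral_mono_of_nonneg (Filter.Eventually.of_forall fun s => abs_nonneg _)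
          ((hi y).add (hi y'))
        refine Filter.Eventually.of_forall fun s => ?_
        have hb : |ψ ((s - y) / a) - ψ ((s - y') / a)| ≤ c := by
          refine (hlip _ _).trans (le_of_eq ?_)
          rw [← sub_div, abs_div, abs_of_pos ha, hc, ← mul_div_assoc, abs_sub_comm y y']
          congr 3; ring
        change _ ≤ (Set.Icc (y - a * R) (y + a * R)).indicator (fun _ => c) s
          + (Set.Icc (y' - a * R) (y' + a * R)).indicator (fun _ => c) s
        by_cases h1 : s ∈ Set.Icc (y - a * R) (y + a * R)
        · have := Set.indicator_nonneg (s := Set.Icc (y' - a * R) (y' + a * R))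
            (f := fun _ => c) (fun _ _ => hc0) s
          simp only [Set.indicator_of_mem h1]
          linarith
        · by_cases h2 : s ∈ Set.Icc (y' - a * R) (y' + a * R)
          · simp only [Set.indicator_of_mem h2, Set.indicator_of_notMem h1]
            linarith
          · simp only [Set.indicator_of_notMem h2, Set.indicator_of_notMem h1]
            simp [hout y s h1, hout y' s h2]
    _ = 4 * R * L * |y - y'| := by
        rw [integral_add (hi y) (hi y'), hI, hI, hc]
        field_simp
        ring

lemma integrable_kde {n : ℕ} {ψ : ℝ → ℝ} (hi : Integrable ψ) {a : ℝ} (ha : 0 < a)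
    (y : Fin n → ℝ) : Integrable (kde n a ψ y) := by
  unfold kde
  exact (integrable_finsetSum _ fun j _ => integrable_scaled hi ha (y j)).const_mul _

lemma integral_kde {n : ℕ} (hn : 1 ≤ n) {ψ : ℝ → ℝ} (hi : Integrable ψ) (h1 : ∫ s, ψ s = 1)
    {a : ℝ} (ha : 0 < a) (y : Fin n → ℝ) : ∫ s, kde n a ψ y s = 1 := by
  unfold kde
  have : (0 : ℝ) < n := by exact_mod_cast hn
  rw [integral_const_mul, integral_finsetSum _ fun j _ => integrable_scaled hi ha (y j)]
  simp only [integral_scaled ψ ha, h1]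
  simp
  field_simp

lemma kde_nonneg {n : ℕ} {ψ : ℝ → ℝ} (h0 : ∀ s, 0 ≤ ψ s)
    {a : ℝ} (ha : 0 < a) (y : Fin n → ℝ) (s : ℝ) : 0 ≤ kde n a ψ y s := by
  unfold kde
  exact mul_nonneg (by positivity) (Finset.sum_nonneg fun j _ => h0 _)

lemma kde_diff_int {n : ℕ} {ψ : ℝ → ℝ} (hi : Integrable ψ) {L R a : ℝ} (hL : 0 ≤ L) (hR : 0 < R)
    (ha : 0 < a) (hlip : ∀ a b : ℝ, |ψ a - ψ b| ≤ L * |a - b|)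
    (hsupp : ∀ s, R < |s| → ψ s = 0) (y y' : Fin n → ℝ) :
    ∫ s, |kde n a ψ y s - kde n a ψ y' s|
      ≤ (1 / ((n : ℝ) * a)) * ∑ j, 4 * R * L * |y j - y' j| := by
  have hint : ∀ j, Integrable fun s => |ψ ((s - y j) / a) - ψ ((s - y' j) / a)| := fun j =>
    ((integrable_scaled hi ha (y j)).sub (integrable_scaled hi ha (y' j))).abs
  calc ∫ s, |kde n a ψ y s - kde n a ψ y' s|
      ≤ ∫ s, (1 / ((n : ℝ) * a)) * ∑ j, |ψ ((s - y j) / a) - ψ ((s - y' j) / a)| := by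
        apply integral_mono_of_nonneg (Filter.Eventually.of_forall fun s => abs_nonneg _)
        · exact (integrable_finsetSum _ fun j _ => hint j).const_mul _
        · refine Filter.Eventually.of_forall fun s => ?_
          simp only [kde]
          rw [← mul_sub, ← Finset.sum_sub_distrib, abs_mul, abs_of_nonneg (by positivity)]
          exact mul_le_mul_of_nonneg_left (Finset.abs_sum_le_sum_abs _ _) (by positivity)
    _ = (1 / ((n : ℝ) * a)) * ∑ j, ∫ s, |ψ ((s - y j) / a) - ψ ((s - y' j) / a)| := by
        rw [integral_const_mul, integral_finsetSum _ fun j _ => hint j]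
    _ ≤ _ := by
        refine mul_le_mul_of_nonneg_left (Finset.sum_le_sum fun j _ => ?_) (by positivity)
        exact shift_int hL hR ha hlip hsupp _ _

/-- L1 error functional -/
def Ferr (n : ℕ) (a : ℝ) (ψ h : ℝ → ℝ) (y : Fin n → ℝ) : ℝ := ∫ s, |kde n a ψ y s - h s|

lemma Ferr_sub_le {n : ℕ} {ψ h : ℝ → ℝ} (hh : Integrable h) (hi : Integrable ψ)
    {L R a : ℝ} (hL : 0 ≤ L) (hR : 0 < R)
    (ha : 0 < a) (hlip : ∀ a b : ℝ, |ψ a - ψ b| ≤ L * |a - b|)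
    (hsupp : ∀ s, R < |s| → ψ s = 0) (y y' : Fin n → ℝ) :
    Ferr n a ψ h y - Ferr n a ψ h y' ≤ (1 / ((n : ℝ) * a)) * ∑ j, 4 * R * L * |y j - y' j| := by
  refine le_trans ?_ (kde_diff_int hi hL hR ha hlip hsupp y y')
  have i1 := integrable_kde hi ha y
  have i2 := integrable_kde hi ha y'
  unfold Ferr
  have e : (∫ s, |kde n a ψ y s - h s|) - ∫ s, |kde n a ψ y' s - h s|
      = ∫ s, (|kde n a ψ y s - h s| - |kde n a ψ y' s - h s|) :=
    (integral_sub (i1.sub hh).abs (i2.sub hh).abs).symm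
  rw [e]
  apply integral_mono ((i1.sub hh).abs.sub (i2.sub hh).abs) (i1.sub i2).abs
  intro s
  have := abs_sub_abs_le_abs_sub (kde n a ψ y s - h s) (kde n a ψ y' s - h s)
  simpa using this

lemma Ferr_nonneg {n : ℕ} {ψ h : ℝ → ℝ} {a : ℝ} (y : Fin n → ℝ) : 0 ≤ Ferr n a ψ h y :=
  integral_nonneg fun _ => abs_nonneg _

lemma Ferr_le_two {n : ℕ} (hn : 1 ≤ n) {ψ h : ℝ → ℝ} (hh : Integrable h) (hh0 : ∀ s, 0 ≤ h s)
    (hh1 : ∫ s, h s = 1)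
    (hi : Integrable ψ) (h0 : ∀ s, 0 ≤ ψ s) (h1 : ∫ s, ψ s = 1)
    {a : ℝ} (ha : 0 < a) (y : Fin n → ℝ) : Ferr n a ψ h y ≤ 2 := by
  have i1 := integrable_kde hi ha y
  calc Ferr n a ψ h y ≤ ∫ s, (kde n a ψ y s + h s) := by
        apply integral_mono (i1.sub hh).abs (i1.add hh)
        intro s
        have := kde_nonneg h0 ha y s
        have := hh0 s
        simp only [Pi.sub_apply, Pi.add_apply]
        rw [abs_le]; constructor <;> linarith
    _ = 2 := by rw [integral_add i1 hh, integral_kde hn hi h1 ha, hh1]; norm_num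

/-- bias bound -/
lemma bias_bound {ψ h : ℝ → ℝ} (hh : Integrable h) (hhm : Measurable h) (hi : Integrable ψ)
    (hψm : Measurable ψ) (h0 : ∀ s, 0 ≤ ψ s) (h1 : ∫ s, ψ s = 1) {R a C' β : ℝ} (hR : 0 < R)
    (ha : 0 < a) (hC' : 0 < C') (hβ : 0 < β)
    (hreg : ∀ σ : ℝ, (∫ s, |h s - h (s - σ)|) ≤ C' * |σ| ^ β)
    (hsupp : ∀ s, R < |s| → ψ s = 0) :
    Integrable (fun s => ∫ u, ψ u * h (s - a * u)) ∧
    ∫ s, |(∫ u, ψ u * h (s - a * u)) - h s| ≤ C' * R ^ β * a ^ β := by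
  have hI : Integrable (fun p : ℝ × ℝ => ψ p.2 * h (p.1 - a * p.2)) (volume.prod volume) := by
    rw [integrable_prod_iff' (by fun_prop)]
    constructor
    · exact Filter.Eventually.of_forall fun u => (hh.comp_sub_right (a * u)).const_mul (ψ u)
    · simp only [norm_mul]
      have : ∀ u : ℝ, ∫ s, ‖ψ u‖ * ‖h (s - a * u)‖ = ‖ψ u‖ * ∫ s, ‖h s‖ := by
        intro u
        rw [integral_const_mul, integral_sub_right_eq_self (fun s => ‖h s‖)]
      simp only [this]
      exact hi.norm.mul_const _
  have hJ : Integrable (fun p : ℝ × ℝ => ψ p.2 * h p.1) (volume.prod volume) := by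
    have := hh.mul_prod hi
    simpa [mul_comm] using this
  have hD : Integrable (fun p : ℝ × ℝ => |ψ p.2 * (h p.1 - h (p.1 - a * p.2))|)
      (volume.prod volume) := by
    have := (hJ.sub hI).abs
    simpa [mul_sub] using this
  refine ⟨hI.integral_prod_left, ?_⟩
  calc ∫ s, |(∫ u, ψ u * h (s - a * u)) - h s|
      ≤ ∫ s, ∫ u, |ψ u * (h s - h (s - a * u))| := by
        apply integral_mono_of_nonneg (Filter.Eventually.of_forall fun s => abs_nonneg _)
          hD.integral_prod_left
        filter_upwards [hI.prod_right_ae] with s hs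
        rw [abs_sub_comm]
        have : h s = ∫ u, ψ u * h s := by rw [integral_mul_const, h1, one_mul]
        rw [this, ← integral_sub (hi.mul_const _) hs]
        simp only [← this, ← mul_sub]
        exact abs_integral_le_integral_abs
    _ = ∫ u, ∫ s, |ψ u * (h s - h (s - a * u))| := integral_integral_swap hD
    _ ≤ ∫ u, ψ u * (C' * R ^ β * a ^ β) := by
        apply integral_mono hD.integral_prod_right (hi.mul_const _)
        intro u
        simp only [abs_mul, abs_of_nonneg (h0 u)]
        rw [integral_const_mul]
        by_cases hu : R < |u|
        · simp [hsupp u hu]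
        · refine mul_le_mul_of_nonneg_left ?_ (h0 u)
          refine (hreg (a * u)).trans ?_
          rw [mul_assoc, ← Real.mul_rpow hR.le ha.le]
          refine mul_le_mul_of_nonneg_left (Real.rpow_le_rpow (abs_nonneg _) ?_ hβ.le) hC'.le
          rw [abs_mul, abs_of_pos ha, mul_comm]
          exact mul_le_mul_of_nonneg_right (not_lt.1 hu) ha.le
    _ = _ := by rw [integral_mul_const, h1, one_mul]

end helpers

section helpers2

lemma kde_sepLip {n : ℕ} (hn : 1 ≤ n) {ψ : ℝ → ℝ} {L a : ℝ} (ha : 0 < a)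
    (hlip : ∀ a b : ℝ, |ψ a - ψ b| ≤ L * |a - b|) (s : ℝ) :
    SepLip (fun y : Fin n → ℝ => kde n a ψ y s) (fun _ => L / (n * a ^ 2)) := by
  intro x j y
  have hn0 : (0 : ℝ) < n := by exact_mod_cast hn
  simp only [kde]
  rw [← mul_sub, ← Finset.sum_sub_distrib, Finset.sum_eq_single j]
  · rw [abs_mul, abs_of_nonneg (by positivity), Function.update_self]
    calc _ ≤ 1 / (n * a) * (L * |(s - x j) / a - (s - y) / a|) :=
          mul_le_mul_of_nonneg_left (hlip _ _) (by positivity)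
      _ = _ := by
          rw [← sub_div, abs_div, abs_of_pos ha, Real.dist_eq, abs_sub_comm (x j) y]
          have : s - x j - (s - y) = y - x j := by ring
          rw [this]
          field_simp
  · intro i _ hij
    rw [Function.update_of_ne hij]; simp
  · simp

lemma Ferr_sepLip {n : ℕ} (hn : 1 ≤ n) {ψ h : ℝ → ℝ} (hh : Integrable h) (hi : Integrable ψ)
    {L R a : ℝ} (hL : 0 ≤ L) (hR : 0 < R)
    (ha : 0 < a) (haR : 4 * R * a ≤ 1) (hlip : ∀ a b : ℝ, |ψ a - ψ b| ≤ L * |a - b|)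
    (hsupp : ∀ s, R < |s| → ψ s = 0) :
    SepLip (Ferr n a ψ h) (fun _ => L / (n * a ^ 2)) := by
  intro x j y
  have hn0 : (0 : ℝ) < n := by exact_mod_cast hn
  have key : ∀ c : ℝ, 0 ≤ c → (1 / ((n : ℝ) * a)) * (4 * R * L * c) ≤ L / (n * a ^ 2) * c := by
    intro c hc
    rw [show (1 / ((n : ℝ) * a)) * (4 * R * L * c) = (4 * R * a) * (L / (n * a ^ 2) * c) by
      field_simp]
    exact mul_le_of_le_one_left (by positivity) haR
  have hs : ∑ i, 4 * R * L * |x i - Function.update x j y i| = 4 * R * L * |x j - y| := by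
    rw [Finset.sum_eq_single j]
    · simp
    · intro i _ hij
      rw [Function.update_of_ne hij]; simp
    · simp
  have h1 := Ferr_sub_le hh hi hL hR ha hlip hsupp x (Function.update x j y)
  have h2 := Ferr_sub_le hh hi hL hR ha hlip hsupp (Function.update x j y) x
  simp only [abs_sub_comm (Function.update x j y _)] at h2
  rw [hs] at h1 h2
  have := key |x j - y| (abs_nonneg _)
  rw [Real.dist_eq, abs_le]
  constructor <;> linarith

lemma Ferr_cont {n : ℕ} {ψ h : ℝ → ℝ} (hh : Integrable h) (hi : Integrable ψ)
    {L R a : ℝ} (hL : 0 ≤ L) (hR : 0 < R)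
    (ha : 0 < a) (hlip : ∀ a b : ℝ, |ψ a - ψ b| ≤ L * |a - b|)
    (hsupp : ∀ s, R < |s| → ψ s = 0) : Continuous (Ferr n a ψ h) := by
  have hC : 0 ≤ (1 / ((n : ℝ) * a)) * ∑ _j : Fin n, 4 * R * L := by positivity
  have : LipschitzWith ⟨_, hC⟩ (Ferr n a ψ h) := by
    apply LipschitzWith.of_le_add_mul
    intro y y'
    have := Ferr_sub_le hh hi hL hR ha hlip hsupp y y'
    have h2 : (1 / ((n : ℝ) * a)) * ∑ j, 4 * R * L * |y j - y' j|
        ≤ (1 / ((n : ℝ) * a)) * (∑ _j : Fin n, 4 * R * L) * dist y y' := by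
      rw [mul_assoc (1 / ((n : ℝ) * a)), Finset.sum_mul]
      refine mul_le_mul_of_nonneg_left (Finset.sum_le_sum fun j _ => ?_) (by positivity)
      refine mul_le_mul_of_nonneg_left ?_ (by positivity)
      exact dist_le_pi_dist y y' j
    have h3 : Ferr n a ψ h y ≤ Ferr n a ψ h y' +
      (1 / ((n : ℝ) * a)) * (∑ _j : Fin n, 4 * R * L) * dist y y' := by linarith
    exact h3
  exact this.continuous

lemma sum_const_rpow {n : ℕ} (hn : 1 ≤ n) {L a q : ℝ} (hL : 0 ≤ L) (ha : 0 < a) :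
    (∑ _j : Fin n, (L / (n * a ^ 2)) ^ 2) ^ (q / 2) = (L / (Real.sqrt n * a ^ 2)) ^ q := by
  have hn0 : (0 : ℝ) < n := by exact_mod_cast hn
  have : ∑ _j : Fin n, (L / (n * a ^ 2)) ^ 2 = (L / (Real.sqrt n * a ^ 2)) ^ (2 : ℝ) := by
    rw [Finset.sum_const, Finset.card_univ, Fintype.card_fin, nsmul_eq_mul, Real.rpow_two,
      div_pow, div_pow, mul_pow, mul_pow, Real.sq_sqrt hn0.le]
    field_simp
  rw [this, ← Real.rpow_mul (by positivity)]
  congr 1; ring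

lemma first_moment {μ : Measure ℝ} [IsProbabilityMeasure μ] {g : ℝ → ℝ} (hg : Measurable g)
    {M : ℝ} (hM : ∀ x, |g x| ≤ M) {q : ℝ} (hq : 2 ≤ q) {C B : ℝ} (hC : 0 < C) (hB : 0 ≤ B)
    (hm : ∫ x, |g x| ^ q ∂μ ≤ C * B ^ q) : ∫ x, |g x| ∂μ ≤ C ^ q⁻¹ * B := by
  have i1 : Integrable (fun x => |g x|) μ :=
    Integrable.of_bound hg.abs.aestronglyMeasurable M
      (Filter.Eventually.of_forall fun x => by simpa using hM x)
  have i2 : Integrable (fun x => |g x| ^ q) μ :=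
    Integrable.of_bound (hg.abs.pow_const q).aestronglyMeasurable (M ^ q)
      (Filter.Eventually.of_forall fun x => by
        rw [Real.norm_of_nonneg (by positivity)]
        exact Real.rpow_le_rpow (abs_nonneg _) (hM x) (by linarith))
  have hj := (convexOn_rpow (p := q) (by linarith)).map_integral_le (μ := μ)
    (f := fun x => |g x|)
    (continuousOn_id.rpow_const fun x _ => Or.inr (by linarith)) isClosed_Ici
    (Filter.Eventually.of_forall fun x => Set.mem_Ici.2 (abs_nonneg _)) i1 i2
  have h0 : 0 ≤ ∫ x, |g x| ∂μ := integral_nonneg fun _ => abs_nonneg _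
  have h3 : (∫ x, |g x| ∂μ) ^ q ≤ (C ^ q⁻¹ * B) ^ q := by
    rw [Real.mul_rpow (by positivity) hB, ← Real.rpow_mul hC.le,
      inv_mul_cancel₀ (by linarith), Real.rpow_one]
    exact hj.trans hm
  exact (Real.rpow_le_rpow_iff h0 (by positivity) (by linarith)).1 h3

lemma density_facts {μ : Measure ℝ} [IsProbabilityMeasure μ] {h : ℝ → ℝ} (hhm : Measurable h)
    (hh0 : ∀ s, 0 ≤ h s)
    (hdens : μ = MeasureTheory.volume.withDensity fun s => ENNReal.ofReal (h s)) :
    Integrable h ∧ ∫ s, h s = 1 := by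
  have h1 : ∫⁻ s, ENNReal.ofReal (h s) = 1 := by
    have := measure_univ (μ := μ)
    rw [hdens, withDensity_apply _ MeasurableSet.univ] at this
    simpa using this
  constructor
  · refine ⟨hhm.aestronglyMeasurable, ?_⟩
    rw [hasFiniteIntegral_iff_ofReal (Filter.Eventually.of_forall hh0), h1]
    simp
  · rw [integral_eq_lintegral_of_nonneg_ae (Filter.Eventually.of_forall hh0)
      hhm.aestronglyMeasurable, h1]
    simp

lemma mean_kde {μ : Measure ℝ} [IsProbabilityMeasure μ] {h : ℝ → ℝ} (hhm : Measurable h)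
    (hh0 : ∀ s, 0 ≤ h s)
    (hdens : μ = MeasureTheory.volume.withDensity fun s => ENNReal.ofReal (h s))
    {T : ℝ → ℝ} (hT : Measurable T) (hinv : μ.map T = μ)
    {ψ : ℝ → ℝ} (hψ : Measurable ψ) {M : ℝ} (hM : ∀ s, |ψ s| ≤ M)
    {n : ℕ} (hn : 1 ≤ n) {a : ℝ} (ha : 0 < a) (s : ℝ) :
    ∫ z, kde n a ψ (fun i => T^[(i : ℕ)] z) s ∂μ = ∫ u, ψ u * h (s - a * u) := by
  have hn0 : (0 : ℝ) < n := by exact_mod_cast hn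
  have hmp : ∀ j : ℕ, MeasurePreserving (T^[j]) μ μ := fun j =>
    (MeasurePreserving.mk hT hinv).iterate j
  have hit : ∀ j : ℕ, ∫ z, ψ ((s - T^[j] z) / a) ∂μ = ∫ z, ψ ((s - z) / a) ∂μ := by
    intro j
    have h2 := integral_map (μ := μ) (hmp j).measurable.aemeasurable
      (f := fun z => ψ ((s - z) / a)) (by
        have : Measurable fun z => ψ ((s - z) / a) := by fun_prop
        exact this.aestronglyMeasurable)
    rw [(hmp j).map_eq] at h2
    exact h2.symm
  have hint : ∀ j : ℕ, Integrable (fun z => ψ ((s - T^[j] z) / a)) μ := by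
    intro j
    refine Integrable.of_bound ?_ M (Filter.Eventually.of_forall fun x => hM _)
    have := (hmp j).measurable
    have h2 : Measurable fun z => ψ ((s - T^[j] z) / a) := by fun_prop
    exact h2.aestronglyMeasurable
  have hd : ∫ z, ψ ((s - z) / a) ∂μ = ∫ z, ψ ((s - z) / a) * h z := by
    conv_lhs => rw [hdens]
    rw [integral_withDensity_eq_integral_toReal_smul (by fun_prop)
      (Filter.Eventually.of_forall fun _ => ENNReal.ofReal_lt_top)]
    refine integral_congr_ae (Filter.Eventually.of_forall fun z => ?_)
    simp only [ENNReal.toReal_ofReal (hh0 z), smul_eq_mul]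
    ring
  have hcv : ∫ z, ψ ((s - z) / a) * h z = a * ∫ u, ψ u * h (s - a * u) := by
    have e1 := integral_sub_left_eq_self (fun z => ψ (z / a) * h (s - z)) volume s
    have e2 := Measure.integral_comp_div (fun u => ψ u * h (s - a * u)) a
    simp only [sub_sub_cancel] at e1
    rw [e1]
    rw [abs_of_pos ha, smul_eq_mul] at e2
    rw [← e2]
    refine integral_congr_ae (Filter.Eventually.of_forall fun z => ?_)
    simp only [mul_div_cancel₀ z ha.ne']
  simp only [kde]
  rw [integral_const_mul, integral_finsetSum _ fun (j : Fin n) _ => hint (j : ℕ)]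
  simp only [hit, hd, hcv]
  simp
  field_simp

end helpers2

section helpers3

lemma kde_abs_le {n : ℕ} {ψ : ℝ → ℝ} {M a : ℝ} (ha : 0 < a) (hM : ∀ s, |ψ s| ≤ M)
    (y : Fin n → ℝ) (s : ℝ) : |kde n a ψ y s| ≤ (1 / ((n : ℝ) * a)) * ∑ _j : Fin n, M := by
  unfold kde
  rw [abs_mul, abs_of_nonneg (by positivity)]
  refine mul_le_mul_of_nonneg_left ?_ (by positivity)
  exact (Finset.abs_sum_le_sum_abs _ _).trans (Finset.sum_le_sum fun j _ => hM _)

lemma kde_meas {n : ℕ} {ψ : ℝ → ℝ} (hψ : Measurable ψ) (a : ℝ) {T : ℝ → ℝ} (hT : Measurable T) :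
    Measurable fun p : ℝ × ℝ => kde n a ψ (fun i => T^[(i : ℕ)] p.1) p.2 := by
  unfold kde
  refine Measurable.const_mul (Finset.measurable_sum _ fun j _ => ?_) _
  have := hT.iterate (j : ℕ)
  fun_prop

lemma mean_bound
    {X : Set ℝ} (hXm : MeasurableSet X) {M0 : ℝ} (hM0 : 0 ≤ M0) (hX : ∀ x ∈ X, |x| ≤ M0)
    {T : ℝ → ℝ} (hT : Measurable T) (hTX : Set.MapsTo T X X)
    {μ : Measure ℝ} [IsProbabilityMeasure μ] (hμX : μ X = 1) (hinv : μ.map T = μ)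
    {h : ℝ → ℝ} (hhm : Measurable h) (hh0 : ∀ s, 0 ≤ h s)
    (hdens : μ = MeasureTheory.volume.withDensity fun s => ENNReal.ofReal (h s))
    {C' β : ℝ} (hC' : 0 < C') (hβ : 0 < β)
    (hreg : ∀ σ : ℝ, (∫ s, |h s - h (s - σ)|) ≤ C' * |σ| ^ β)
    {q : ℝ} (hq : 2 ≤ q) {Cq : ℝ} (hCq : 0 < Cq)
    {n : ℕ} (hn : 1 ≤ n) {L a R : ℝ} (hL : 0 ≤ L) (ha : 0 < a) (hR : 0 < R) (haR : R * a ≤ 1)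
    (hconc : ∀ (K : (Fin n → ℝ) → ℝ), SepLip K (fun _ => L / (n * a ^ 2)) →
      ∫ x, |K (fun i => T^[(i : ℕ)] x)
          - ∫ z, K (fun i => T^[(i : ℕ)] z) ∂μ| ^ q ∂μ
        ≤ Cq * (L / (Real.sqrt n * a ^ 2)) ^ q)
    {ψ : ℝ → ℝ} (h0 : ∀ s, 0 ≤ ψ s) (hi : Integrable ψ) (h1 : ∫ s, ψ s = 1)
    (hsupp : ∀ s, R < |s| → ψ s = 0) {M : ℝ} (hM : ∀ s, |ψ s| ≤ M)
    (hlip : ∀ a b : ℝ, |ψ a - ψ b| ≤ L * |a - b|) :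
    ∫ x, Ferr n a ψ h (fun i => T^[(i : ℕ)] x) ∂μ
      ≤ 2 * (M0 + 1) * (Cq ^ q⁻¹ * (L / (Real.sqrt n * a ^ 2))) + C' * R ^ β * a ^ β := by
  obtain ⟨hh, hh1⟩ := density_facts hhm hh0 hdens
  have hψm : Measurable ψ := (psi_cont hL hlip).measurable
  obtain ⟨him, hbias⟩ := bias_bound hh hhm hi hψm h0 h1 hR ha hC' hβ hreg hsupp
  have hmean := mean_kde hhm hh0 hdens hT hinv hψm hM hn ha
  set m : ℝ → ℝ := fun s => ∫ u, ψ u * h (s - a * u) with hm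
  have hmean' : ∀ s, ∫ z, kde n a ψ (fun i => T^[(i : ℕ)] z) s ∂μ = m s := hmean
  have hkm := kde_meas (n := n) hψm a hT
  set o : ℝ → Fin n → ℝ := fun x i => T^[(i : ℕ)] x with ho
  set I : Set ℝ := Set.Icc (-(M0 + 1)) (M0 + 1) with hI
  have hXae : ∀ᵐ x ∂μ, x ∈ X := by
    rw [← prob_compl_eq_zero_iff hXm] at hμX
    exact hμX
  have hkz : ∀ x ∈ X, ∀ s, s ∉ I → kde n a ψ (o x) s = 0 := by
    intro x hx s hs
    unfold kde
    rw [Finset.sum_eq_zero, mul_zero]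
    intro j _
    apply hsupp
    have h3 : |T^[(j : ℕ)] x| ≤ M0 := hX _ (hTX.iterate j hx)
    rw [abs_div, abs_of_pos ha, lt_div_iff₀ ha]
    have h4 : M0 + 1 < |s| := by
      by_contra hcon
      exact hs (abs_le.1 (not_lt.1 hcon))
    have h5 := abs_sub_abs_le_abs_sub s (T^[(j : ℕ)] x)
    simp only [ho]
    linarith
  have hmz : ∀ s, s ∉ I → m s = 0 := by
    intro s hs
    rw [← hmean' s]
    apply integral_eq_zero_of_ae
    filter_upwards [hXae] with x hx
    exact hkz x hx s hs
  have hpi : Integrable (fun p : ℝ × ℝ => |kde n a ψ (o p.1) p.2 - m p.2|)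
      (μ.prod (volume.restrict I)) := by
    haveI : IsFiniteMeasure (volume.restrict I) := ⟨by
      rw [Measure.restrict_apply_univ, hI, Real.volume_Icc]; exact ENNReal.ofReal_lt_top⟩
    have i1 : Integrable (fun p : ℝ × ℝ => kde n a ψ (o p.1) p.2)
        (μ.prod (volume.restrict I)) :=
      Integrable.of_bound hkm.aestronglyMeasurable _
        (Filter.Eventually.of_forall fun p => kde_abs_le ha hM _ _)
    have i2 : Integrable (fun p : ℝ × ℝ => m p.2) (μ.prod (volume.restrict I)) :=
      (him.restrict (s := I)).comp_snd μ
    exact (i1.sub i2).abs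
  have hpt : ∀ x ∈ X, Ferr n a ψ h (o x)
      ≤ (∫ s in I, |kde n a ψ (o x) s - m s|) + C' * R ^ β * a ^ β := by
    intro x hx
    have i1 := integrable_kde hi ha (o x)
    have e : ∫ s in I, |kde n a ψ (o x) s - m s| = ∫ s, |kde n a ψ (o x) s - m s| := by
      apply setIntegral_eq_integral_of_forall_compl_eq_zero
      intro s hs
      rw [hkz x hx s hs, hmz s hs]; simp
    rw [e]
    have e2 : (∫ s, |kde n a ψ (o x) s - m s|) + ∫ s, |m s - h s|
        = ∫ s, (|kde n a ψ (o x) s - m s| + |m s - h s|) :=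
      (integral_add (i1.sub him).abs (him.sub hh).abs).symm
    have e3 : Ferr n a ψ h (o x) ≤ ∫ s, (|kde n a ψ (o x) s - m s| + |m s - h s|) :=
      integral_mono (i1.sub hh).abs ((i1.sub him).abs.add (him.sub hh).abs)
        (fun s => abs_sub_le _ _ _)
    linarith
  have hV : ∀ s, ∫ x, |kde n a ψ (o x) s - m s| ∂μ
      ≤ Cq ^ q⁻¹ * (L / (Real.sqrt n * a ^ 2)) := by
    intro s
    have hms : Measurable fun x => kde n a ψ (o x) s :=
      hkm.comp (measurable_id.prodMk measurable_const)
    refine first_moment (M := (1 / ((n : ℝ) * a)) * (∑ _j : Fin n, M) + |m s|)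
      (hms.sub_const (m s)) (fun x => ?_) hq hCq (by positivity) ?_
    · exact (abs_sub _ _).trans (by
        have := kde_abs_le ha hM (o x) s
        linarith)
    · have := hconc _ (kde_sepLip hn ha hlip s)
      rw [hmean' s] at this
      exact this
  calc ∫ x, Ferr n a ψ h (o x) ∂μ
      ≤ ∫ x, ((∫ s in I, |kde n a ψ (o x) s - m s|) + C' * R ^ β * a ^ β) ∂μ := by
        apply integral_mono_of_nonneg (Filter.Eventually.of_forall fun x => Ferr_nonneg _)
        · exact hpi.integral_prod_left.add (integrable_const _)
        · filter_upwards [hXae] with x hx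
          exact hpt x hx
    _ = (∫ x, (∫ s in I, |kde n a ψ (o x) s - m s|) ∂μ) + C' * R ^ β * a ^ β := by
        rw [integral_add hpi.integral_prod_left (integrable_const _)]
        simp
    _ = (∫ s in I, (∫ x, |kde n a ψ (o x) s - m s| ∂μ)) + C' * R ^ β * a ^ β := by
        rw [integral_integral_swap hpi]
    _ ≤ (∫ s in I, (Cq ^ q⁻¹ * (L / (Real.sqrt n * a ^ 2)))) + C' * R ^ β * a ^ β := by
        gcongr ?_ + _
        apply integral_mono hpi.integral_prod_right (integrableOn_const (by simp [hI]))
        intro s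
        exact hV s
    _ = _ := by
        rw [setIntegral_const, Measure.real, hI, Real.volume_Icc,
          ENNReal.toReal_ofReal (by linarith), smul_eq_mul]
        ring

end helpers3

set_option maxHeartbeats 2000000 in
/-- `L¹` deviation bound for the observed kernel density estimator
`h̃_n(y₀,…,y_{n-1};s) = (1/(n αₙ)) ∑_{j<n} ψ((s - y_j)/αₙ)`, `y_j = T^j x + ε ξ_j`,
for a system satisfying the polynomial concentration inequality with moment `q ≥ 2`. -/
theorem observed_kernel_density_estimator_polynomial
    (X : Set ℝ) (hXb : Bornology.IsBounded X) (hXm : MeasurableSet X)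
    (T : ℝ → ℝ) (hT : Measurable T) (hTX : Set.MapsTo T X X)
    (μ : Measure ℝ) [IsProbabilityMeasure μ] (hμX : μ X = 1) (hinv : μ.map T = μ)
    (h : ℝ → ℝ) (hh_meas : Measurable h) (hh_nonneg : ∀ s, 0 ≤ h s)
    (hdens : μ = MeasureTheory.volume.withDensity fun s => ENNReal.ofReal (h s))
    (C' β : ℝ) (hC' : 0 < C') (hβ : 0 < β)
    (hreg : ∀ σ : ℝ, (∫ s, |h s - h (s - σ)|) ≤ C' * |σ| ^ β)
    (q : ℝ) (hq : 2 ≤ q) (Cq : ℝ) (hCq : 0 < Cq)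
    (hconc : ∀ (n : ℕ), 1 ≤ n → ∀ (K : (Fin n → ℝ) → ℝ) (L : Fin n → ℝ), SepLip K L →
      ∫ x, |K (fun i => T^[(i : ℕ)] x)
          - ∫ z, K (fun i => T^[(i : ℕ)] z) ∂μ| ^ q ∂μ
        ≤ Cq * (∑ j, L j ^ 2) ^ (q / 2))
    (ψ : ℝ → ℝ) (hψ_nonneg : ∀ s, 0 ≤ ψ s) (hψ_supp : HasCompactSupport ψ)
    (Lψ : ℝ) (hLψ : 0 ≤ Lψ) (hψ_lip : ∀ a b : ℝ, |ψ a - ψ b| ≤ Lψ * |a - b|)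
    (hψ_int : (∫ s, ψ s) = 1)
    (α : ℕ → ℝ) (hα : ∀ n, 0 < α n)
    (P : Measure ℝ) [IsProbabilityMeasure P] (hP : ∀ᵐ ξ ∂P, |ξ| ≤ 1) :
    ∃ Cψ : ℝ, 0 < Cψ ∧ ∃ Dq : ℝ, 0 < Dq ∧ ∀ ε : ℝ, 0 < ε → ∀ (n : ℕ), 1 ≤ n →
      ∀ t : ℝ, Cψ * ((α n) ^ β + 1 / (Real.sqrt n * (α n) ^ 2)) < t →
      ((μ.prod (Measure.pi fun _ : Fin n => P))
          {p | t + Lψ * ε / (α n) ^ 2 < ∫ s, |(1 / ((n : ℝ) * α n))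
            * ∑ j : Fin n, ψ ((s - (T^[(j : ℕ)] p.1 + ε * p.2 j)) / α n) - h s|}).toReal
        ≤ Dq * ((1 + ε) * Lψ / (t * Real.sqrt n * (α n) ^ 2)) ^ q := by
  obtain ⟨hh, hh1⟩ := density_facts hh_meas hh_nonneg hdens
  have hψc : Continuous ψ := psi_cont hLψ hψ_lip
  have hi : Integrable ψ := hψc.integrable_of_hasCompactSupport hψ_supp
  obtain ⟨M, hM⟩ : ∃ M, ∀ s, |ψ s| ≤ M := hψ_supp.exists_bound_of_continuous hψc
  obtain ⟨R, hR, hsupp⟩ : ∃ R : ℝ, 0 < R ∧ ∀ s, R < |s| → ψ s = 0 := by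
    obtain ⟨R, hR, hs⟩ := hψ_supp.isBounded.exists_pos_norm_le
    refine ⟨R, hR, fun s hs' => ?_⟩
    by_contra hcon
    exact absurd (hs s (subset_tsupport ψ hcon)) (not_le.2 hs')
  obtain ⟨M0, hM0, hX⟩ := hXb.exists_pos_norm_le
  set A : ℝ := 2 * (M0 + 1) * (Cq ^ q⁻¹ * Lψ) with hA
  have hA0 : 0 ≤ A := by positivity
  set a0 : ℝ := 1 / (4 * R) with ha0
  have ha0p : 0 < a0 := by positivity
  set Cψ : ℝ := 2 * A + 2 * (C' * R ^ β) + 2 / a0 ^ β with hCψ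
  have hRβ : 0 < R ^ β := Real.rpow_pos_of_pos hR β
  have ha0β : 0 < a0 ^ β := Real.rpow_pos_of_pos ha0p β
  have hd0 : 0 < 2 / a0 ^ β := by positivity
  have hCψ0 : 0 < Cψ := by positivity
  refine ⟨Cψ, hCψ0, Cq * 2 ^ q, by positivity, ?_⟩
  intro ε hε n hn t ht
  have hn0 : (0 : ℝ) < n := by exact_mod_cast hn
  have hsn : 0 < Real.sqrt n := Real.sqrt_pos.2 hn0
  set a : ℝ := α n with haa
  have ha : 0 < a := hα n
  have haβ : 0 < a ^ β := Real.rpow_pos_of_pos ha β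
  have hb : 0 < 1 / (Real.sqrt n * a ^ 2) := by positivity
  have ht0 : 0 < t := lt_trans (by positivity) ht
  have hrhs : 0 ≤ Cq * 2 ^ q * ((1 + ε) * Lψ / (t * Real.sqrt n * a ^ 2)) ^ q := by positivity
  change ((μ.prod (Measure.pi fun _ : Fin n => P))
    {p | t + Lψ * ε / a ^ 2 < Ferr n a ψ h (fun j => T^[(j : ℕ)] p.1 + ε * p.2 j)}).toReal ≤ _
  by_cases ht2 : 2 ≤ t
  · have : {p : ℝ × (Fin n → ℝ) | t + Lψ * ε / a ^ 2
        < Ferr n a ψ h (fun j => T^[(j : ℕ)] p.1 + ε * p.2 j)} = ∅ := by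
      rw [Set.eq_empty_iff_forall_notMem]
      intro p hp
      have h1 := Ferr_le_two hn hh hh_nonneg hh1 hi hψ_nonneg hψ_int ha
        (fun j => T^[(j : ℕ)] p.1 + ε * p.2 j)
      have h2 : 0 ≤ Lψ * ε / a ^ 2 := by positivity
      have h3 : t + Lψ * ε / a ^ 2
        < Ferr n a ψ h (fun j => T^[(j : ℕ)] p.1 + ε * p.2 j) := hp
      linarith
    rw [this]
    simpa using hrhs
  push Not at ht2
  have haa0 : a ≤ a0 := by
    by_contra hcon
    push Not at hcon
    have h1 : a0 ^ β ≤ a ^ β := Real.rpow_le_rpow ha0p.le hcon.le hβ.le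
    have h2 : 2 ≤ Cψ * a ^ β := by
      calc (2 : ℝ) = 2 / a0 ^ β * a0 ^ β := by field_simp
        _ ≤ Cψ * a ^ β := by
          apply mul_le_mul _ h1 ha0β.le hCψ0.le
          have : 0 ≤ C' * R ^ β := by positivity
          rw [hCψ]; linarith
    have h3 : 0 < Cψ * (1 / (Real.sqrt n * a ^ 2)) := by positivity
    rw [mul_add] at ht
    linarith
  have haR : 4 * R * a ≤ 1 := by
    calc 4 * R * a ≤ 4 * R * a0 := mul_le_mul_of_nonneg_left haa0 (by positivity)
      _ = 1 := by rw [ha0]; field_simp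
  have haR' : R * a ≤ 1 := by
    have : 0 < R * a := by positivity
    linarith
  set B : ℝ := Lψ / (Real.sqrt n * a ^ 2) with hB
  have hB0 : 0 ≤ B := by positivity
  have hconc' : ∀ (K : (Fin n → ℝ) → ℝ), SepLip K (fun _ => Lψ / (n * a ^ 2)) →
      ∫ x, |K (fun i => T^[(i : ℕ)] x)
          - ∫ z, K (fun i => T^[(i : ℕ)] z) ∂μ| ^ q ∂μ
        ≤ Cq * B ^ q := by
    intro K hK
    have := hconc n hn K _ hK
    rwa [sum_const_rpow hn hLψ ha] at this
  have hEF := mean_bound hXm hM0.le hX hT hTX hμX hinv hh_meas hh_nonneg hdens hC' hβ hreg hq hCq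
    hn hLψ ha hR haR' hconc' hψ_nonneg hi hψ_int hsupp hM hψ_lip
  have hcF := hconc' _ (Ferr_sepLip hn hh hi hLψ hR ha haR hψ_lip hsupp)
  set F : ℝ → ℝ := fun x => Ferr n a ψ h (fun i : Fin n => T^[(i : ℕ)] x) with hF
  have hFm : Measurable F := (Ferr_cont hh hi hLψ hR ha hψ_lip hsupp).measurable.comp
    (measurable_pi_lambda _ fun i => hT.iterate (i : ℕ))
  set EF : ℝ := ∫ x, F x ∂μ with hEFd
  have hEF' : EF ≤ A * (1 / (Real.sqrt n * a ^ 2)) + C' * R ^ β * a ^ β := by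
    refine hEF.trans (le_of_eq ?_)
    rw [hA]; ring
  have hEFt : EF ≤ t / 2 := by
    have h1 : 0 ≤ (A + 2 / a0 ^ β / 2) * a ^ β := by positivity
    have h2 : 0 ≤ (C' * R ^ β + 2 / a0 ^ β / 2) * (1 / (Real.sqrt n * a ^ 2)) := by positivity
    rw [hCψ] at ht
    nlinarith
  have hEF0 : 0 ≤ EF := integral_nonneg fun _ => Ferr_nonneg _
  have hF2 : ∀ x, F x ≤ 2 := fun x => Ferr_le_two hn hh hh_nonneg hh1 hi hψ_nonneg hψ_int ha _
  have hF0 : ∀ x, 0 ≤ F x := fun x => Ferr_nonneg _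
  have hGi : Integrable (fun x => |F x - EF| ^ q) μ := by
    refine Integrable.of_bound ((hFm.sub_const EF).abs.pow_const q).aestronglyMeasurable
      (2 ^ q) (Filter.Eventually.of_forall fun x => ?_)
    rw [Real.norm_of_nonneg (by positivity)]
    apply Real.rpow_le_rpow (abs_nonneg _) _ (by linarith)
    rw [abs_le]
    constructor
    · linarith [hF0 x]
    · linarith [hF2 x]
  have hmk := mul_meas_ge_le_integral_of_nonneg
    (Filter.Eventually.of_forall fun x => by positivity) hGi ((t / 2) ^ q)
  have hmono : (μ.prod (Measure.pi fun _ : Fin n => P))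
      {p | t + Lψ * ε / a ^ 2 < Ferr n a ψ h (fun j => T^[(j : ℕ)] p.1 + ε * p.2 j)}
      ≤ μ {x | (t / 2) ^ q ≤ |F x - EF| ^ q} := by
    have hξ : ∀ᵐ p ∂(μ.prod (Measure.pi fun _ : Fin n => P)), ∀ j, |p.2 j| ≤ 1 := by
      have h1 : ∀ᵐ ξ ∂(Measure.pi fun _ : Fin n => P), ∀ j, |ξ j| ≤ 1 := by
        rw [ae_all_iff]
        intro j
        exact (Measure.tendsto_eval_ae_ae (μ := fun _ : Fin n => P) (i := j)).eventually hP
      exact Measure.quasiMeasurePreserving_snd.ae h1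
    calc _ ≤ (μ.prod (Measure.pi fun _ : Fin n => P))
          ({x | (t / 2) ^ q ≤ |F x - EF| ^ q} ×ˢ Set.univ) := by
          apply measure_mono_ae
          filter_upwards [hξ] with p hp hlt
          refine Set.mem_prod.2 ⟨?_, Set.mem_univ _⟩
          change (t / 2) ^ q ≤ |F p.1 - EF| ^ q
          have h3 : t + Lψ * ε / a ^ 2
            < Ferr n a ψ h (fun j => T^[(j : ℕ)] p.1 + ε * p.2 j) := hlt
          have h4 := Ferr_sub_le hh hi hLψ hR ha hψ_lip hsupp
            (fun j : Fin n => T^[(j : ℕ)] p.1 + ε * p.2 j) (fun j : Fin n => T^[(j : ℕ)] p.1)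
          have h5 : (1 / ((n : ℝ) * a)) * ∑ j : Fin n, 4 * R * Lψ *
              |(T^[(j : ℕ)] p.1 + ε * p.2 j) - T^[(j : ℕ)] p.1| ≤ Lψ * ε / a ^ 2 := by
            calc _ ≤ (1 / ((n : ℝ) * a)) * ∑ j : Fin n, 4 * R * Lψ * ε := by
                  refine mul_le_mul_of_nonneg_left (Finset.sum_le_sum fun j _ => ?_)
                    (by positivity)
                  refine mul_le_mul_of_nonneg_left ?_ (by positivity)
                  rw [add_sub_cancel_left, abs_mul, abs_of_pos hε]
                  exact mul_le_of_le_one_right hε.le (hp j)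
              _ = (4 * R * a) * (Lψ * ε / a ^ 2) := by
                  rw [Finset.sum_const, Finset.card_univ, Fintype.card_fin, nsmul_eq_mul]
                  field_simp
              _ ≤ _ := mul_le_of_le_one_left (by positivity) haR
          have h6 : t < F p.1 := by
            have := h4.trans h5
            change _ - F p.1 ≤ _ at this
            linarith
          apply Real.rpow_le_rpow (by positivity) _ (by linarith)
          exact le_trans (by linarith) (le_abs_self _)
      _ = _ := by rw [Measure.prod_prod]; simp
  have hμr : μ.real {x | (t / 2) ^ q ≤ |F x - EF| ^ q} ≤ Cq * B ^ q / (t / 2) ^ q := by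
    rw [le_div_iff₀ (by positivity), mul_comm]
    exact hmk.trans hcF
  calc _ ≤ μ.real {x | (t / 2) ^ q ≤ |F x - EF| ^ q} :=
        ENNReal.toReal_mono (measure_ne_top _ _) hmono
    _ ≤ Cq * B ^ q / (t / 2) ^ q := hμr
    _ = Cq * 2 ^ q * (B / t) ^ q := by
        rw [Real.div_rpow hB0 ht0.le, Real.div_rpow ht0.le (by norm_num)]
        field_simp
    _ ≤ _ := by
        refine mul_le_mul_of_nonneg_left (Real.rpow_le_rpow (by positivity) ?_ (by linarith))
          (by positivity)
        rw [hB, div_div, show Real.sqrt n * a ^ 2 * t = t * Real.sqrt n * a ^ 2 by ring]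
        gcongr
        nlinarith
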